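/- Let G be a graph, l ≥ 2 an integer, and k ≥ max{l·Δ(G), l·|V(G)|/(2(l−1))}. Then for every k-assignment L of G there exists a proper L-coloring of G that uses no color c more than ⌈η(c)/k⌉ times. -/

import Mathlib

open Finset

/-- The multiplicity of a color `c` in a list assignment `L`: the number of
vertices whose list contains `c`. -/
def eta {V : Type*} [Fintype V] (L : V → Finset ℕ) (c : ℕ) : ℕ :=
  (Finset.univ.filter fun v => c ∈ L v).card

/-- `f` is a proportional `L`-coloring of `G` (with lists of size `k`): a proper
`L`-coloring in which each color `c` of the palette is used `⌊η(c)/k⌋` or `⌈η(c)/k⌉` times. -/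
def IsProportionalColoring {V : Type*} [Fintype V] (G : SimpleGraph V) (k : ℕ)
    (L : V → Finset ℕ) (f : V → ℕ) : Prop :=
  (∀ v, f v ∈ L v) ∧ (∀ u v, G.Adj u v → f u ≠ f v) ∧
  ∀ c, (∃ v, c ∈ L v) →
    (Finset.univ.filter fun v => f v = c).card = eta L c / k ∨
    (Finset.univ.filter fun v => f v = c).card = (eta L c + k - 1) / k

/-- `G` is proportionally `k`-choosable: every `k`-assignment admits a proportional coloring. -/
def ProportionallyChoosable {V : Type*} [Fintype V] (G : SimpleGraph V) (k : ℕ) : Prop :=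
  ∀ L : V → Finset ℕ, (∀ v, (L v).card = k) → ∃ f : V → ℕ, IsProportionalColoring G k L f

/-- A capacity respecting (not necessarily proper) list coloring, by Hall's theorem. -/
theorem exists_capacity_coloring {V : Type*} [Fintype V] (k : ℕ) (hk : 0 < k)
    (L : V → Finset ℕ) (hL : ∀ v, (L v).card = k) :
    ∃ f : V → ℕ, (∀ v, f v ∈ L v) ∧
      ∀ c : ℕ, (Finset.univ.filter fun v => f v = c).card ≤ (eta L c + k - 1) / k := by
  classical
  obtain ⟨cap, hcap⟩ : ∃ cap : ℕ → ℕ, ∀ c, cap c = (eta L c + k - 1) / k := ⟨_, fun _ => rfl⟩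
  have hcapk : ∀ c, eta L c ≤ cap c * k := by
    intro c
    rw [hcap]
    have h1 := Nat.div_add_mod (eta L c + k - 1) k
    have h2 := Nat.mod_lt (eta L c + k - 1) hk
    rw [mul_comm] at h1
    omega
  let t : V → Finset (Σ _ : ℕ, ℕ) := fun v => (L v).sigma fun c => Finset.range (cap c)
  have hall : ∀ S : Finset V, S.card ≤ (S.biUnion t).card := by
    intro S
    have e : S.biUnion t = (S.biUnion L).sigma fun c => Finset.range (cap c) := by
      ext ⟨c, i⟩
      simp only [t, Finset.mem_biUnion, Finset.mem_sigma]
      grind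
    rw [e, Finset.card_sigma]
    simp only [Finset.card_range]
    have h1 : S.card * k = ∑ c ∈ S.biUnion L, (S.filter fun v => c ∈ L v).card := by
      have := Finset.sum_card_bipartiteAbove_eq_sum_card_bipartiteBelow
        (s := S) (t := S.biUnion L) (fun v c => c ∈ L v)
      simp only [Finset.bipartiteAbove, Finset.bipartiteBelow] at this
      rw [← this, ← smul_eq_mul, ← Finset.sum_const]
      refine Finset.sum_congr rfl fun v hv => ?_
      rw [← hL v]
      congr 1
      ext c
      simp only [Finset.mem_filter, Finset.mem_biUnion]
      grind
    have h2 : S.card * k ≤ (∑ c ∈ S.biUnion L, cap c) * k := by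
      rw [h1, Finset.sum_mul]
      refine Finset.sum_le_sum fun c _ => le_trans ?_ (hcapk c)
      exact Finset.card_le_card (Finset.filter_subset_filter _ (Finset.subset_univ _))
    exact Nat.le_of_mul_le_mul_right h2 hk
  obtain ⟨g, hginj, hg⟩ := (Finset.all_card_le_biUnion_card_iff_exists_injective t).1 hall
  refine ⟨fun v => (g v).1, fun v => (Finset.mem_sigma.1 (hg v)).1, fun c => ?_⟩
  rw [← hcap, ← Finset.card_range (cap c)]
  refine Finset.card_le_card_of_injOn (fun v => (g v).2) ?_ ?_
  · intro v hv
    have hv' : (g v).1 = c := by simpa using hv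
    have := (Finset.mem_sigma.1 (hg v)).2
    rw [hv'] at this
    exact this
  · intro v hv w hw hvw
    have hv' : (g v).1 = c := by simpa using hv
    have hw' : (g w).1 = c := by simpa using hw
    exact hginj (Sigma.ext (hv'.trans hw'.symm) (heq_of_eq hvw))

/-- A capacity respecting coloring with a monochromatic edge can be improved. -/
theorem improve_coloring {V : Type*} [Fintype V] [DecidableEq V] (G : SimpleGraph V)
    [DecidableRel G.Adj] (k : ℕ) (hk : 0 < k)
    (hb : Fintype.card V + 2 * G.maxDegree ≤ 2 * k)
    (L : V → Finset ℕ) (hL : ∀ v, (L v).card = k) (f : V → ℕ) (hf : ∀ v, f v ∈ L v)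
    (hc : ∀ c : ℕ, (Finset.univ.filter fun v => f v = c).card ≤ (eta L c + k - 1) / k)
    (u w : V) (huw : G.Adj u w) (hfuw : f u = f w) :
    ∃ g : V → ℕ, (∀ v, g v ∈ L v) ∧
      (∀ c : ℕ, (Finset.univ.filter fun v => g v = c).card ≤ (eta L c + k - 1) / k) ∧
      (∀ a b, G.Adj a b → g a = g b → f a = f b) ∧ g u ≠ g w := by
  have hne : u ≠ w := huw.ne
  -- the class of `f u` is exactly `{u, w}`
  have hetan : ∀ c, eta L c ≤ Fintype.card V := fun c => Finset.card_le_univ _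
  have hcap2 : ∀ c, (eta L c + k - 1) / k ≤ 2 := by
    intro c
    have := hetan c
    rw [← Nat.lt_succ_iff, Nat.div_lt_iff_lt_mul hk]
    simp only [Nat.succ_eq_add_one]
    omega
  have hclass : ∀ b, f b = f u → b = u ∨ b = w := by
    intro b hbu
    by_contra hcon
    push Not at hcon
    have h3 : ({u, w, b} : Finset V).card = 3 := by
      rw [Finset.card_eq_three]
      exact ⟨u, w, b, hne, hcon.1.symm, hcon.2.symm, rfl⟩
    have hsub : ({u, w, b} : Finset V) ⊆ Finset.univ.filter fun v => f v = f u := by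
      intro z hz
      simp only [Finset.mem_insert, Finset.mem_singleton] at hz
      simp only [Finset.mem_filter, Finset.mem_univ, true_and]
      rcases hz with rfl | rfl | rfl
      · rfl
      · exact hfuw.symm
      · exact hbu
    have := Finset.card_le_card hsub
    have := hc (f u)
    have := hcap2 (f u)
    omega
  have heta : k + 1 ≤ eta L (f u) := by
    have hsub : ({u, w} : Finset V) ⊆ Finset.univ.filter fun v => f v = f u := by
      intro z hz
      simp only [Finset.mem_insert, Finset.mem_singleton] at hz
      simp only [Finset.mem_filter, Finset.mem_univ, true_and]
      rcases hz with rfl | rfl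
      · rfl
      · exact hfuw.symm
    have h1 := Finset.card_le_card hsub
    rw [Finset.card_pair hne] at h1
    have h2 := h1.trans (hc (f u))
    rw [Nat.le_div_iff_mul_le hk] at h2
    omega
  by_contra hno
  let Y : Finset V := (Finset.univ.filter fun x => f u ∉ L x) ∪ (G.neighborFinset w).erase u
  let N : Finset V := (G.neighborFinset u).erase w
  have hY : Y.card + k + 2 ≤ Fintype.card V + G.maxDegree := by
    have h1 : Y.card ≤ _ := Finset.card_union_le _ _
    have h2 : eta L (f u) + (Finset.univ.filter fun x => f u ∉ L x).card = Fintype.card V := by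
      have := Finset.card_filter_add_card_filter_not (s := (Finset.univ : Finset V))
        (fun x => f u ∈ L x)
      exact this
    have h3 : u ∈ G.neighborFinset w := by simpa using huw.symm
    have h4 := Finset.card_erase_add_one h3
    have h5 := G.degree_le_maxDegree w
    rw [G.card_neighborFinset_eq_degree] at h4
    omega
  have hN : N.card + 1 ≤ G.maxDegree := by
    have h3 : w ∈ G.neighborFinset u := by simpa using huw
    have h4 := Finset.card_erase_add_one h3
    have h5 := G.degree_le_maxDegree u
    rw [G.card_neighborFinset_eq_degree] at h4
    exact h4.le.trans h5
  -- every other color of `L u` appears on `Y ∪ N`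
  have key : ∀ d ∈ (L u).erase (f u), ∃ x ∈ Y ∪ N, f x = d := by
    intro d hd
    obtain ⟨hdu, hdL⟩ := Finset.mem_erase.1 hd
    by_contra hcon
    push Not at hcon
    have hnb : ∀ y, G.Adj u y → f y ≠ d := by
      intro y hy hfy
      by_cases hyw : y = w
      · subst hyw; exact hdu (hfy.symm.trans hfuw.symm)
      · exact hcon y (Finset.mem_union_right _ (by simp [N, hyw, hy])) hfy
    by_cases hm : (Finset.univ.filter fun v => f v = d).Nonempty
    · obtain ⟨x, hx⟩ := hm
      have hfx : f x = d := by simpa using hx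
      have hxu : x ≠ u := by rintro rfl; exact hdu hfx.symm
      have hxw : x ≠ w := by rintro rfl; exact hdu (hfx.symm.trans hfuw.symm)
      have hxY : x ∉ Y := fun h => hcon x (Finset.mem_union_left _ h) hfx
      have hxY' : f u ∈ L x ∧ ¬ G.Adj w x := by
        simp only [Y, Finset.mem_union, Finset.mem_filter, Finset.mem_univ, true_and,
          Finset.mem_erase, SimpleGraph.mem_neighborFinset] at hxY
        tauto
      have gu : f (Equiv.swap u x u) = d := by rw [Equiv.swap_apply_left, hfx]
      have gx : f (Equiv.swap u x x) = f u := by rw [Equiv.swap_apply_right]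
      have go : ∀ z, z ≠ u → z ≠ x → f (Equiv.swap u x z) = f z := fun z h1 h2 => by
        rw [Equiv.swap_apply_of_ne_of_ne h1 h2]
      refine hno ⟨fun v => f (Equiv.swap u x v), ?_, ?_, ?_, ?_⟩
      · intro v
        by_cases h1 : v = u
        · subst h1; simp only [gu]; exact hdL
        · by_cases h2 : v = x
          · subst h2; simp only [gx]; exact hxY'.1
          · simp only [go v h1 h2]; exact hf v
      · intro c
        refine le_trans (Finset.card_le_card_of_injOn (Equiv.swap u x) ?_ ?_) (hc c)
        · intro z hz
          simpa using hz
        · exact (Equiv.swap u x).injective.injOn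
      · have main : ∀ a b, G.Adj a b → f (Equiv.swap u x a) = f (Equiv.swap u x b) →
            a ≠ u ∧ a ≠ x := by
          intro a b hab he
          constructor
          · rintro rfl
            rw [gu] at he
            by_cases h2 : b = x
            · subst h2; rw [gx] at he; exact hdu he
            · rw [go b hab.ne' h2] at he
              exact hnb b hab he.symm
          · rintro rfl
            rw [gx] at he
            by_cases h2 : b = u
            · subst h2; rw [gu] at he; exact hdu he.symm
            · rw [go b h2 hab.ne'] at he
              rcases hclass b he.symm with h | h
              · exact h2 h
              · subst h; exact hxY'.2 hab.symm
        intro a b hab he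
        obtain ⟨h1, h2⟩ := main a b hab he
        obtain ⟨h3, h4⟩ := main b a hab.symm he.symm
        simpa only [go a h1 h2, go b h3 h4] using he
      · simp only [gu, go w hne.symm hxw.symm]
        rw [← hfuw]; exact hdu
    · rw [Finset.not_nonempty_iff_eq_empty] at hm
      refine hno ⟨Function.update f u d, ?_, ?_, ?_, ?_⟩
      · intro v
        by_cases h1 : v = u
        · subst h1; simpa using hdL
        · simpa [h1] using hf v
      · intro c
        by_cases hcd : c = d
        · subst hcd
          have h1 : (Finset.univ.filter fun v => Function.update f u c v = c) ⊆ {u} := by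
            intro z hz
            by_contra hzu
            have hzu' : z ≠ u := by simpa using hzu
            have : z ∈ Finset.univ.filter fun v => f v = c := by simpa [hzu'] using hz
            rw [hm] at this
            simp at this
          have h2 := Finset.card_le_card h1
          rw [Finset.card_singleton] at h2
          refine h2.trans ?_
          rw [Nat.le_div_iff_mul_le hk]
          have : 0 < eta L c := Finset.card_pos.2 ⟨u, by simpa using hdL⟩
          omega
        · refine le_trans (Finset.card_le_card ?_) (hc c)
          intro z hz
          by_cases hzu : z = u
          · subst hzu
            exact absurd (by simpa using hz) (Ne.symm hcd)
          · simpa [hzu] using hz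
      · have main : ∀ a b, G.Adj a b → Function.update f u d a = Function.update f u d b →
            a ≠ u := by
          rintro a b hab he rfl
          rw [Function.update_self, Function.update_of_ne hab.ne'] at he
          exact hnb b hab he.symm
        intro a b hab he
        have h1 := main a b hab he
        have h2 := main b a hab.symm he.symm
        rwa [Function.update_of_ne h1, Function.update_of_ne h2] at he
      · rw [Function.update_self, Function.update_of_ne hne.symm, ← hfuw]; exact hdu
  have hsub : (L u).erase (f u) ⊆ (Y ∪ N).image f := by
    intro d hd
    obtain ⟨x, hx, hxd⟩ := key d hd
    exact Finset.mem_image.2 ⟨x, hx, hxd⟩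
  have h1 := (Finset.card_le_card hsub).trans (Finset.card_image_le.trans (Finset.card_union_le _ _))
  have h2 := Finset.card_erase_add_one (hf u)
  rw [hL u] at h2
  omega

theorem stmt_15 {V : Type*} [Fintype V] (G : SimpleGraph V) [DecidableRel G.Adj]
    (l k : ℕ) (hl : 2 ≤ l)
    (hk1 : l * G.maxDegree ≤ k) (hk2 : l * Fintype.card V ≤ 2 * (l - 1) * k)
    (L : V → Finset ℕ) (hL : ∀ v, (L v).card = k) :
    ∃ f : V → ℕ, (∀ v, f v ∈ L v) ∧ (∀ u v, G.Adj u v → f u ≠ f v) ∧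
      ∀ c : ℕ, (∃ v, c ∈ L v) →
        (Finset.univ.filter fun v => f v = c).card ≤ (eta L c + k - 1) / k := by
  classical
  have hb : Fintype.card V + 2 * G.maxDegree ≤ 2 * k := by
    obtain ⟨m, rfl⟩ : ∃ m, l = m + 1 := ⟨l - 1, by omega⟩
    simp only [Nat.add_sub_cancel] at hk2
    refine Nat.le_of_mul_le_mul_left (c := m + 1) ?_ (by omega)
    nlinarith
  rcases Nat.eq_zero_or_pos k with hk0 | hk
  · have hV : IsEmpty V := Fintype.card_eq_zero_iff.1 (by omega)
    exact ⟨fun _ => 0, fun v => hV.elim v, fun v => hV.elim v, fun c ⟨v, _⟩ => hV.elim v⟩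
  let M : (V → ℕ) → ℕ := fun f =>
    (Finset.univ.filter fun p : V × V => G.Adj p.1 p.2 ∧ f p.1 = f p.2).card
  have step : ∀ n : ℕ, ∀ f : V → ℕ, M f = n → (∀ v, f v ∈ L v) →
      (∀ c : ℕ, (Finset.univ.filter fun v => f v = c).card ≤ (eta L c + k - 1) / k) →
      ∃ f : V → ℕ, (∀ v, f v ∈ L v) ∧ (∀ u v, G.Adj u v → f u ≠ f v) ∧
      ∀ c : ℕ, (∃ v, c ∈ L v) →
        (Finset.univ.filter fun v => f v = c).card ≤ (eta L c + k - 1) / k := by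
    intro n
    induction n using Nat.strong_induction_on with
    | _ n ih =>
      intro f hM hf hc
      by_cases hp : ∀ u v, G.Adj u v → f u ≠ f v
      · exact ⟨f, hf, hp, fun c _ => hc c⟩
      · push Not at hp
        obtain ⟨u, w, huw, hfuw⟩ := hp
        obtain ⟨g, hg, hgc, hgm, hguw⟩ := improve_coloring G k hk hb L hL f hf hc u w huw hfuw
        refine ih (M g) ?_ g rfl hg hgc
        rw [← hM]
        refine Finset.card_lt_card ?_
        rw [Finset.ssubset_iff_of_subset]
        · exact ⟨(u, w), by simp [huw, hfuw], by simp [hguw]⟩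
        · rintro ⟨a, b⟩ hab
          simp only [Finset.mem_filter, Finset.mem_univ, true_and] at hab ⊢
          exact ⟨hab.1, hgm a b hab.1 hab.2⟩
  obtain ⟨f, hf, hc⟩ := exists_capacity_coloring k hk L hL
  exact step _ f rfl hf hc
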